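/- Main theorem, weak version: Let K be a field, S_1, …, S_n sets of localities on K, t ∈ K^×, x_1, …, x_n ∈ K and z_1, …, z_n ∈ K^×. Assume: (U) Assumption (U) holds for S = S_1 ∪ ⋯ ∪ S_n and t; (T) each S_i is compact in the Zariski topology; (I) for any valuation ring O_w of K having a refinement in S_i and a refinement in S_j we have x_i − x_j ∈ z_i·O_w and z_i·O_w = z_j·O_w, and moreover the sets S_1, …, S_n are pairwise t-independent. Then there exists x ∈ K with x − x_i ∈ z_i·O_v for all v ∈ S_i, for i = 1, …, n. -/

import Mathlib

namespace PaperApprox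

variable {K : Type*} [Field K]

/-- The "maximal ideal" `m_O = O \ O^×` of a ball `O`, where `O^× = O ∩ O⁻¹` and
`O⁻¹ = {x⁻¹ : 0 ≠ x ∈ O} = {x | x ≠ 0 ∧ x⁻¹ ∈ O}`. -/
def mball (O : Set K) : Set K := O \ (O ∩ {x | x ≠ 0 ∧ x⁻¹ ∈ O})

/-- The scaled set `z·S`. -/
def scale (z : K) (S : Set K) : Set K := {y | ∃ s ∈ S, y = z * s}

/-- A positive cone of a field ordering. -/
def IsOrderingCone (P : Set K) : Prop :=
  (∀ a ∈ P, ∀ b ∈ P, a + b ∈ P) ∧ (∀ a ∈ P, ∀ b ∈ P, a * b ∈ P) ∧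
    (∀ x : K, x ∈ P ∨ -x ∈ P) ∧ ∀ x : K, x ∈ P → -x ∈ P → x = 0

/-- `x ≤_P y` for a positive cone `P`. -/
def coneLE (P : Set K) (a b : K) : Prop := b - a ∈ P

/-- `x <_P y` for a positive cone `P`. -/
def coneLT (P : Set K) (a b : K) : Prop := b - a ∈ P ∧ a ≠ b

/-- The unit interval `{x : -1 ≤_P x ≤_P 1}` of an ordering. -/
def orderingBall (P : Set K) : Set K := {x | x + 1 ∈ P ∧ 1 - x ∈ P}

/-- `O` is the valuation ring of a (Krull) valuation on `K`. -/
def IsValuationLocality (O : Set K) : Prop := ∃ A : ValuationSubring K, O = (A : Set K)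

/-- `O` is the unit interval of a field ordering of `K`. -/
def IsOrderingLocality (O : Set K) : Prop := ∃ P : Set K, IsOrderingCone P ∧ O = orderingBall P

/-- `O` is the closed unit ball of an absolute value on `K`. -/
def IsAbsLocality (O : Set K) : Prop := ∃ f : AbsoluteValue K ℝ, O = {x | f x ≤ 1}

/-- A locality on `K`, identified with its ring/ball `O`. -/
def IsLocality (O : Set K) : Prop := IsValuationLocality O ∨ IsOrderingLocality O ∨ IsAbsLocality O

/-- `W` is the finest common coarsening of the localities `O₁`, `O₂`. -/
def IsFCC (O₁ O₂ W : Set K) : Prop :=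
  IsLocality W ∧ O₁ ⊆ W ∧ O₂ ⊆ W ∧ ∀ W', IsLocality W' → O₁ ⊆ W' → O₂ ⊆ W' → W ⊆ W'

/-- Two subsets `A`, `B` of `W` have the same image in the residue field `W/m_W`. -/
def SameResidue (W A B : Set K) : Prop :=
  (∀ x ∈ A, ∃ y ∈ B, x - y ∈ mball W) ∧ ∀ y ∈ B, ∃ x ∈ A, x - y ∈ mball W

/-- Incomparability of localities. -/
def Incomp (O₁ O₂ : Set K) : Prop := ¬O₁ ⊆ O₂ ∧ ¬O₂ ⊆ O₁

/-- Strong incomparability: incomparable, and the induced localities on the residue field of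
the finest common coarsening are distinct (their rings, i.e. the images of `O₁` and `O₂`,
differ). -/
def StronglyIncomp (O₁ O₂ : Set K) : Prop :=
  Incomp O₁ O₂ ∧ ∀ W, IsFCC O₁ O₂ W → ¬SameResidue W O₁ O₂

/-- `t`-independence of localities. -/
def TIndep (t : K) (O₁ O₂ : Set K) : Prop :=
  (∀ W, IsFCC O₁ O₂ W → t ∈ W ∧ t⁻¹ ∈ W) ∧
    (IsOrderingLocality O₁ → IsOrderingLocality O₂ → StronglyIncomp O₁ O₂)

/-- `t`-independence of valuation rings: `t` and `t⁻¹` lie in the smallest valuation ring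
containing both. -/
def TIndepVal (t : K) (O₁ O₂ : Set K) : Prop :=
  ∀ W : Set K, IsValuationLocality W → O₁ ⊆ W → O₂ ⊆ W →
    (∀ W', IsValuationLocality W' → O₁ ⊆ W' → O₂ ⊆ W' → W ⊆ W') → t ∈ W ∧ t⁻¹ ∈ W

/-- `t`-independence of sets of localities. -/
def SetTIndep (t : K) (S₁ S₂ : Set (Set K)) : Prop := ∀ v ∈ S₁, ∀ w ∈ S₂, TIndep t v w

/-- Incomparability of sets of localities. -/
def SetIncomp (S₁ S₂ : Set (Set K)) : Prop := ∀ v ∈ S₁, ∀ w ∈ S₂, Incomp v w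

/-- Independence of localities: the field topologies they induce on `K` (with the sets
`z·m_v`, `z ∈ K^×`, as neighbourhood bases of `0`) are distinct. -/
def IndepLoc (O₁ O₂ : Set K) : Prop :=
  ¬((∀ z : K, z ≠ 0 → ∃ z' : K, z' ≠ 0 ∧ scale z' (mball O₂) ⊆ scale z (mball O₁)) ∧
     ∀ z : K, z ≠ 0 → ∃ z' : K, z' ≠ 0 ∧ scale z' (mball O₁) ⊆ scale z (mball O₂))

/-- The Zariski topology on localities/balls of `K`. -/
def zarTop (K : Type*) [Field K] : TopologicalSpace (Set K) :=
  TopologicalSpace.generateFrom {U | ∃ x : K, U = {O : Set K | x ∈ O}}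

/-- The Hochster dual of the Zariski topology. -/
def zarStarTop (K : Type*) [Field K] : TopologicalSpace (Set K) :=
  TopologicalSpace.generateFrom {U | ∃ x : K, U = {O : Set K | x ∈ mball O}}

/-- The constructible topology. -/
def conTop (K : Type*) [Field K] : TopologicalSpace (Set K) :=
  TopologicalSpace.generateFrom
    ({U | ∃ x : K, U = {O : Set K | x ∈ O}} ∪ {U | ∃ x : K, U = {O : Set K | x ∈ mball O}})

/-- The Harrison topology on orderings (positive cones) of `K`. -/
def harrisonTop (K : Type*) [Field K] : TopologicalSpace (Set K) :=
  TopologicalSpace.generateFrom {U | ∃ x : K, x ≠ 0 ∧ U = {P : Set K | x ∈ P}}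

/-- Condition (i): `f(O) ⊆ O`. -/
def CondI (f : Polynomial K) (O : Set K) : Prop := ∀ x ∈ O, f.eval x ∈ O

/-- Condition (ii): `f(x) ∉ t·m_O` for `x ∈ O`. -/
def CondII (t : K) (f : Polynomial K) (O : Set K) : Prop := ∀ x ∈ O, f.eval x ∉ scale t (mball O)

/-- Condition (iii): `f(x) ∈ x^d (O \ t·m_O) ∩ (a_d x^d + x^(d-1) O)` for `x ∉ O`. -/
def CondIII (t : K) (f : Polynomial K) (O : Set K) : Prop :=
  ∀ x : K, x ∉ O →
    f.eval x ∈ scale (x ^ f.natDegree) (O \ scale t (mball O)) ∧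
      ∃ u ∈ O, f.eval x = f.leadingCoeff * x ^ f.natDegree + x ^ (f.natDegree - 1) * u

/-- Condition (iv): `O + O ⊆ t⁻¹·O`. -/
def CondIV (t : K) (O : Set K) : Prop := ∀ a ∈ O, ∀ b ∈ O, a + b ∈ scale t⁻¹ O

/-- Assumption (U) for a set `S` of localities and `t ∈ K^×`. -/
def AssumptionU (S : Set (Set K)) (t : K) : Prop :=
  ∃ f : Polynomial K, 2 ≤ f.natDegree ∧
    ∀ v ∈ S, CondI f v ∧ CondII t f v ∧ CondIII t f v ∧ CondIV t v

/-- Assumption (U-exc) for finitely many sets `S 1, …, S n` of localities and `t ∈ K^×`: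
conditions (i), (iii), (iv) everywhere, and condition (ii) on the infinite `S i`. -/
def AssumptionUExc {n : ℕ} (S : Fin n → Set (Set K)) (t : K) : Prop :=
  ∃ f : Polynomial K, 2 ≤ f.natDegree ∧
    (∀ i, ∀ v ∈ S i, CondI f v ∧ CondIII t f v ∧ CondIV t v) ∧
      ∀ i, (S i).Infinite → ∀ v ∈ S i, CondII t f v

/-- `S_π^e(K)`: valuation rings whose value group has a smallest positive element `γ`
(multiplicatively: a largest element `γ < 1`), such that `ℤγ` is convex and
`0 < v(π) ≤ eγ` (multiplicatively `γ^e ≤ v(π) < 1`). -/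
def SPiE (π : K) (e : ℕ) : Set (Set K) :=
  {O | ∃ A : ValuationSubring K, O = (A : Set K) ∧
    ∃ γ : A.ValueGroup, γ ≠ 0 ∧ γ < 1 ∧
      (∀ δ : A.ValueGroup, δ ≠ 0 → δ < 1 → δ ≤ γ) ∧
      (∀ δ : A.ValueGroup, δ ≠ 0 → ∀ m n : ℤ, γ ^ m ≤ δ → δ ≤ γ ^ n → ∃ k : ℤ, δ = γ ^ k) ∧
      A.valuation π < 1 ∧ γ ^ e ≤ A.valuation π}

/-- `O_w` is convex with respect to the ordering with positive cone `P`. -/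
def ConvexWrtOrdering (P W : Set K) : Prop :=
  ∀ u w : K, u ∈ P → w - u ∈ P → w ∈ W → u ∈ W

/-- Iterated application `φ(x₁, φ(x₂, …))`. -/
def iterPhi (φ : K → K → K) : K → List K → K
  | x, [] => x
  | x, y :: l => φ x (iterPhi φ y l)

/-- Basic closure properties of the ball of a locality. -/
structure Ball (O : Set K) : Prop where
  zero : (0 : K) ∈ O
  one : (1 : K) ∈ O
  neg : ∀ a ∈ O, -a ∈ O
  mul : ∀ a ∈ O, ∀ b ∈ O, a * b ∈ O
  tot : ∀ a : K, a ∈ O ∨ a⁻¹ ∈ O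

lemma Ball.pow {O : Set K} (h : Ball O) {a : K} (ha : a ∈ O) (k : ℕ) : a ^ k ∈ O := by
  induction k with
  | zero => simpa using h.one
  | succ k ih => rw [pow_succ]; exact h.mul _ ih _ ha

lemma cone_order {P : Set K} (hP : IsOrderingCone P) :
    ∃ (_ : LinearOrder K) (_ : IsStrictOrderedRing K), (∀ x : K, x ∈ P ↔ 0 ≤ x) := by
  classical
  obtain ⟨hadd, hmul, htot, hanti⟩ := hP
  have h1 : (1 : K) ∈ P := by
    rcases htot 1 with h | h
    · exact h
    · simpa using hmul _ h _ h
  have h0 : (0 : K) ∈ P := by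
    rcases htot 0 with h | h
    · exact h
    · simpa using h
  let L : LinearOrder K :=
    { le := fun a b => b - a ∈ P
      le_refl := fun a => by simpa using h0
      le_trans := fun a b c hab hbc => by
        have := hadd _ hab _ hbc
        have e : b - a + (c - b) = c - a := by ring
        rwa [e] at this
      le_antisymm := fun a b hab hba => by
        have := hanti (b - a) hab (by simpa using hba)
        exact (sub_eq_zero.mp this).symm
      le_total := fun a b => by
        rcases htot (b - a) with h | h
        · exact Or.inl h
        · exact Or.inr (by simpa using h)
      toDecidableLE := Classical.decRel _ }
  have hle : ∀ a b : K, a ≤ b ↔ b - a ∈ P := fun a b => Iff.rfl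
  have I1 : IsOrderedAddMonoid K :=
    { add_le_add_left := fun a b hab c => by
        rw [hle] at hab ⊢
        simpa using hab }
  have I2 : ZeroLEOneClass K := ⟨by rw [hle]; simpa using h1⟩
  have I3 : IsOrderedRing K := IsOrderedRing.of_mul_nonneg (fun a b ha hb => by
    rw [hle] at ha hb ⊢
    simpa using hmul _ (by simpa using ha) _ (by simpa using hb))
  have I4 : IsStrictOrderedRing K := IsOrderedRing.toIsStrictOrderedRing K
  exact ⟨L, I4, fun x => by rw [hle]; simp⟩

lemma ord_ball {O : Set K} (h : IsOrderingLocality O) :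
    ∃ (_ : LinearOrder K) (_ : IsStrictOrderedRing K), (∀ x : K, x ∈ O ↔ |x| ≤ 1) := by
  obtain ⟨P, hP, rfl⟩ := h
  obtain ⟨L, I, h⟩ := cone_order hP
  refine ⟨L, I, fun x => ?_⟩
  simp only [orderingBall, Set.mem_ofPred_eq, h, abs_le]
  constructor
  · rintro ⟨a, b⟩; constructor <;> linarith
  · rintro ⟨a, b⟩; constructor <;> linarith

lemma ball_of_ord {O : Set K} (h : IsOrderingLocality O) :
    Ball O ∧ (∀ a ∈ O, ∀ b ∈ O, ∃ c ∈ O, a + b = 2 * c) := by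
  obtain ⟨L, I, h⟩ := ord_ball h
  refine ⟨⟨by simp [h], by simp [h], fun a ha => by simpa [h] using ha, fun a ha b hb => ?_,
    fun a => ?_⟩, fun a ha b hb => ⟨(a + b) / 2, ?_, by ring⟩⟩
  · rw [h] at *
    rw [abs_mul]
    exact mul_le_one₀ ha (abs_nonneg _) hb
  · rw [h, h]
    rcases le_total |a| 1 with h1 | h1
    · exact Or.inl h1
    · right; rw [abs_inv]; exact inv_le_one_of_one_le₀ h1
  · rw [h] at *
    rw [abs_le] at *
    constructor <;> linarith [ha.1, ha.2, hb.1, hb.2]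

lemma ball_of_loc {O : Set K} (h : IsLocality O) : Ball O := by
  rcases h with ⟨A, rfl⟩ | h | ⟨f, rfl⟩
  · exact ⟨A.zero_mem, A.one_mem, fun a ha => A.neg_mem _ ha, fun a ha b hb => A.mul_mem _ _ ha hb,
      A.mem_or_inv_mem⟩
  · exact (ball_of_ord h).1
  · refine ⟨by simp, by simp, fun a ha => by simpa using ha, fun a ha b hb => ?_, fun a => ?_⟩
    · simp only [Set.mem_ofPred_eq, map_mul] at *
      exact mul_le_one₀ ha (f.nonneg _) hb
    · simp only [Set.mem_ofPred_eq, map_inv₀]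
      rcases le_total (f a) 1 with h1 | h1
      · exact Or.inl h1
      · exact Or.inr (inv_le_one_of_one_le₀ h1)

/-- The product set of two balls. -/
def prd (A B : Set K) : Set K := {y | ∃ p ∈ A, ∃ q ∈ B, y = p * q}

lemma prd_comm (A B : Set K) : prd A B = prd B A := by
  ext y
  constructor
  · rintro ⟨p, hp, q, hq, rfl⟩; exact ⟨q, hq, p, hp, mul_comm _ _⟩
  · rintro ⟨p, hp, q, hq, rfl⟩; exact ⟨q, hq, p, hp, mul_comm _ _⟩

lemma prd_mul {A B : Set K} (hA : Ball A) (hB : Ball B) {x y : K} (hx : x ∈ prd A B)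
    (hy : y ∈ prd A B) : x * y ∈ prd A B := by
  obtain ⟨p, hp, q, hq, rfl⟩ := hx
  obtain ⟨p', hp', q', hq', rfl⟩ := hy
  exact ⟨p * p', hA.mul _ hp _ hp', q * q', hB.mul _ hq _ hq', by ring⟩

lemma prd_left {A B : Set K} (hB : Ball B) {x : K} (hx : x ∈ A) : x ∈ prd A B :=
  ⟨x, hx, 1, hB.one, by simp⟩

lemma prd_right {A B : Set K} (hA : Ball A) {x : K} (hx : x ∈ B) : x ∈ prd A B :=
  ⟨1, hA.one, x, hx, by simp⟩

lemma prd_pow {A B : Set K} (hA : Ball A) (hB : Ball B) {x : K} (hx : x ∈ prd A B) (k : ℕ) :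
    x ^ k ∈ prd A B := by
  induction k with
  | zero => simpa using prd_left hB hA.one
  | succ k ih => rw [pow_succ]; exact prd_mul hA hB ih hx

/-- The valuation ring generated by `A`, `B`, `s`. -/
lemma exists_gen {A B : Set K} (hA : Ball A) (hB : Ball B) (s : K)
    (hs1 : s⁻¹ ∈ A) (hs0 : s ≠ 0)
    (hs : ∀ a ∈ A, ∀ b ∈ A, ∃ c ∈ A, a + b = s * c) :
    ∃ M : ValuationSubring K, ∀ y, y ∈ M ↔ ∃ k : ℕ, ∃ u ∈ prd A B, y = s ^ k * u := by
  have hmono : ∀ (k l : ℕ) (p : K), p ∈ A → ∃ p' ∈ A, s ^ k * p = s ^ (k + l) * p' := by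
    intro k l p hp
    refine ⟨s⁻¹ ^ l * p, hA.mul _ (hA.pow hs1 l) _ hp, ?_⟩
    rw [pow_add, inv_pow]
    field_simp
  have key : ∀ p ∈ A, ∀ p' ∈ A, ∀ q ∈ B, ∀ q' ∈ B, q ≠ 0 → q⁻¹ * q' ∈ A → ∀ k : ℕ,
      ∃ k' : ℕ, ∃ u ∈ prd A B, s ^ k * (p * q) + s ^ k * (p' * q') = s ^ k' * u := by
    intro p hp p' hp' q hq q' hq' hq0 hr k
    obtain ⟨c, hc, e⟩ := hs p hp (p' * (q⁻¹ * q')) (hA.mul _ hp' _ hr)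
    refine ⟨k + 1, c * q, ⟨c, hc, q, hq, rfl⟩, ?_⟩
    have : p * q + p' * q' = (p + p' * (q⁻¹ * q')) * q := by field_simp
    rw [← mul_add, this, e]; ring
  have hadd : ∀ p ∈ A, ∀ p' ∈ A, ∀ q ∈ B, ∀ q' ∈ B, ∀ k : ℕ,
      ∃ k' : ℕ, ∃ u ∈ prd A B, s ^ k * (p * q) + s ^ k * (p' * q') = s ^ k' * u := by
    intro p hp p' hp' q hq q' hq' k
    by_cases hq0 : q = 0
    · exact ⟨k, p' * q', ⟨p', hp', q', hq', rfl⟩, by simp [hq0]⟩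
    by_cases hq0' : q' = 0
    · exact ⟨k, p * q, ⟨p, hp, q, hq, rfl⟩, by simp [hq0']⟩
    rcases hA.tot (q⁻¹ * q') with h | h
    · exact key p hp p' hp' q hq q' hq' hq0 h k
    · rw [add_comm]
      refine key p' hp' p hp q' hq' q hq hq0' ?_ k
      rwa [mul_inv, inv_inv, mul_comm] at h
  refine ⟨{ carrier := {y | ∃ k : ℕ, ∃ u ∈ prd A B, y = s ^ k * u}
            mul_mem' := ?_, one_mem' := ?_, add_mem' := ?_, zero_mem' := ?_, neg_mem' := ?_
            mem_or_inv_mem' := ?_ }, fun y => Iff.rfl⟩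
  · rintro a b ⟨k, u, hu, rfl⟩ ⟨l, v, hv, rfl⟩
    exact ⟨k + l, u * v, prd_mul hA hB hu hv, by ring⟩
  · exact ⟨0, 1, prd_left hB hA.one, by simp⟩
  · rintro a b ⟨k, u, ⟨p, hp, q, hq, rfl⟩, rfl⟩ ⟨l, v, ⟨p', hp', q', hq', rfl⟩, rfl⟩
    obtain ⟨r, hr, e⟩ := hmono k l p hp
    obtain ⟨r', hr', e'⟩ := hmono l k p' hp'
    obtain ⟨k', u, hu, h⟩ := hadd r hr r' hr' q hq q' hq' (k + l)
    refine ⟨k', u, hu, ?_⟩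
    rw [← h, ← mul_assoc, ← mul_assoc, e, e', add_comm l k]; ring
  · exact ⟨0, 0, prd_left hB hA.zero, by simp⟩
  · rintro a ⟨k, u, ⟨p, hp, q, hq, rfl⟩, rfl⟩
    exact ⟨k, -p * q, ⟨-p, hA.neg _ hp, q, hq, rfl⟩, by ring⟩
  · intro y
    rcases hA.tot y with h | h
    · exact Or.inl ⟨0, y, prd_left hB h, by simp⟩
    · exact Or.inr ⟨0, y⁻¹, prd_left hB h, by simp⟩

lemma ord_growth {O : Set K} (h : IsOrderingLocality O) {x : K} (hx : x ∉ O) :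
    ∃ e ∈ O, ∀ (k : ℕ) (p q : K), q ∈ O → (x - e) * (2 ^ k * (p * q)) = 1 →
      2 / p ∈ O ∨ ∃ N : ℕ, 2 / x ^ N ∈ O := by
  obtain ⟨L, I, h⟩ := ord_ball h
  have main : ∀ x : K, 1 < x → ∀ (k : ℕ) (p q : K), |q| ≤ 1 → (x - 1) * (2 ^ k * (p * q)) = 1 →
      |2 / p| ≤ 1 ∨ ∃ N : ℕ, |2 / x ^ N| ≤ 1 := by
    intro x hx k p q hq e
    by_cases hp : 2 ≤ |p|
    · left
      rw [abs_div, abs_of_pos (by norm_num : (0:K) < 2)]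
      exact div_le_one_of_le₀ hp (abs_nonneg _)
    · right
      push Not at hp
      have hd : 0 < x - 1 := by linarith
      have h2 : (0 : K) < 2 ^ k := by positivity
      have h3 : (x - 1) * (2 ^ k * (|p| * |q|)) = 1 := by
        have := congrArg abs e
        simpa [abs_mul, abs_of_pos hd, abs_of_pos h2] using this
      have h4 : |p| * |q| ≤ 2 := by
        calc |p| * |q| ≤ |p| * 1 := by gcongr
          _ ≤ 2 := by linarith
      have h5 : 1 ≤ (x - 1) * (2 ^ k * 2) := by
        calc (1 : K) = (x - 1) * (2 ^ k * (|p| * |q|)) := h3.symm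
          _ ≤ (x - 1) * (2 ^ k * 2) := by gcongr
      refine ⟨2 ^ (k + 1), ?_⟩
      have h6 := one_add_mul_le_pow (a := x - 1) (by linarith) (2 ^ (k + 1))
      have h7 : (2 : K) ≤ x ^ (2 ^ (k + 1)) := by
        have e1 : 1 + (x - 1) = x := by ring
        rw [e1] at h6
        push_cast at h6
        have e2 : (2 : K) ^ (k + 1) * (x - 1) = (x - 1) * (2 ^ k * 2) := by ring
        rw [e2] at h6
        linarith
      rw [abs_div, abs_of_pos (by norm_num : (0:K) < 2), abs_of_pos (by linarith)]
      exact div_le_one_of_le₀ h7 (by linarith)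
  rw [h, not_le] at hx
  rcases lt_abs.mp hx with hx | hx
  · refine ⟨1, by simp [h], fun k p q hq e => ?_⟩
    simp only [h] at *
    exact main x hx k p q hq e
  · refine ⟨-1, by simp [h], fun k p q hq e => ?_⟩
    simp only [h] at *
    have := main (-x) hx k p (-q) (by simpa using hq) (by linear_combination e)
    rcases this with h | ⟨N, hN⟩
    · exact Or.inl h
    · refine Or.inr ⟨N, ?_⟩
      rw [abs_div, abs_pow, abs_neg] at hN
      rwa [abs_div, abs_pow]

lemma ord_abs {O : Set K} (h : IsOrderingLocality O) (f : AbsoluteValue K ℝ)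
    (hO : O ⊆ {x | f x ≤ 1}) (h2 : 1 < f 2) : {x | f x ≤ 1} ⊆ O := by
  obtain ⟨L, I, h⟩ := ord_ball h
  have arch : ∀ e : K, 0 < e → ∃ k : ℕ, 1 < 2 ^ k * e := by
    intro e he
    by_contra hc
    push Not at hc
    have h3 : ∀ k : ℕ, f 2 ^ k * f e ≤ 1 := by
      intro k
      have : f (2 ^ k * e) ≤ 1 := hO ((h _).2 (by
        rw [abs_of_pos (by positivity)]; exact hc k))
      simpa using this
    have hfe : 0 < f e := f.pos he.ne'
    obtain ⟨k, hk⟩ := pow_unbounded_of_one_lt (1 / f e) h2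
    have := h3 k
    rw [div_lt_iff₀ hfe] at hk
    linarith
  have main : ∀ x : K, f x ≤ 1 → x ≤ 1 := by
    intro x hx
    by_contra hc
    push Not at hc
    obtain ⟨k, hk⟩ := arch (x - 1) (by linarith)
    have h6 := one_add_mul_le_pow (a := x - 1) (by linarith) (2 ^ k)
    have h7 : (2 : K) ≤ x ^ (2 ^ k) := by
      have e1 : 1 + (x - 1) = x := by ring
      rw [e1] at h6
      push_cast at h6
      linarith
    have h8 : f (2 / x ^ (2 ^ k)) ≤ 1 := hO ((h _).2 (by
      rw [abs_div, abs_of_pos (by norm_num : (0:K) < 2), abs_of_pos (by linarith)]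
      exact div_le_one_of_le₀ h7 (by linarith)))
    have hfx : 0 < f x := f.pos (by linarith)
    rw [map_div₀, map_pow, div_le_one (by positivity)] at h8
    have := pow_le_one₀ (n := 2 ^ k) hfx.le hx
    linarith
  intro x hx
  rw [h, abs_le']
  exact ⟨main x hx, main (-x) (by simpa using hx)⟩

lemma ord_pos {P : Set K} (hP : IsOrderingCone P) (x : K) :
    x ∈ P ↔ 1 - x / (1 + x ^ 2) ∈ orderingBall P := by
  obtain ⟨L, I, h⟩ := cone_order hP
  have hp : 0 < 1 + x ^ 2 := by positivity
  simp only [orderingBall, Set.mem_ofPred_eq, h]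
  constructor
  · intro hx
    have h1 : x / (1 + x ^ 2) ≤ 1 := by
      rw [div_le_one hp]; nlinarith [sq_nonneg (x - 1)]
    have h2 : 0 ≤ x / (1 + x ^ 2) := by positivity
    constructor <;> linarith
  · rintro ⟨-, h2⟩
    have h2 : 0 ≤ x / (1 + x ^ 2) := by linarith
    have := mul_nonneg h2 hp.le
    rwa [div_mul_cancel₀ _ hp.ne'] at this

lemma ord_eq {A B : Set K} (hA : IsOrderingLocality A) (hB : IsOrderingLocality B)
    (h : A ⊆ B) : A = B := by
  obtain ⟨P, hP, rfl⟩ := hA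
  obtain ⟨Q, hQ, rfl⟩ := hB
  have hPQ : P ⊆ Q := fun x hx => (ord_pos hQ x).2 (h ((ord_pos hP x).1 hx))
  have : P = Q := by
    refine Set.Subset.antisymm hPQ fun x hx => ?_
    rcases hP.2.2.1 x with h1 | h1
    · exact h1
    · have : x = 0 := hQ.2.2.2 x hx (hPQ h1)
      subst this
      simpa using h1
  rw [this]

lemma abs_case {t : K} {A B : Set K} (hA : IsLocality A) (hB : IsAbsLocality B)
    (hF : ∀ W, IsFCC A B W → t ∈ W ∧ t⁻¹ ∈ W) : t⁻¹ ∈ prd A B := by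
  have bA := ball_of_loc hA
  by_cases hAB : A ⊆ B
  · exact prd_right bA (hF B ⟨Or.inr (Or.inr hB), hAB, subset_rfl, fun W' _ _ h => h⟩).2
  · obtain ⟨x, hx, hx'⟩ := Set.not_subset.mp hAB
    obtain ⟨g, rfl⟩ := hB
    simp only [Set.mem_ofPred_eq, not_le] at hx'
    obtain ⟨N, hN⟩ := pow_unbounded_of_one_lt (g t⁻¹) hx'
    have hx0 : x ≠ 0 := by rintro rfl; simp at hx'; linarith
    refine ⟨x ^ N, bA.pow hx N, t⁻¹ / x ^ N, ?_, by field_simp⟩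
    have : 0 < g x := g.pos hx0
    simp only [Set.mem_ofPred_eq, map_div₀, map_pow]
    rw [div_le_one (by positivity)]
    exact hN.le

lemma val_case {t : K} {A B : Set K} (hA : IsValuationLocality A) (hB : IsLocality B)
    (hF : ∀ W, IsFCC A B W → t ∈ W ∧ t⁻¹ ∈ W) : t⁻¹ ∈ prd A B := by
  have bA := ball_of_loc (Or.inl hA)
  have bB := ball_of_loc hB
  obtain ⟨M, hM⟩ := exists_gen bA bB 1 (by simpa using bA.one) one_ne_zero (by
    obtain ⟨A, rfl⟩ := hA
    intro a ha b hb
    exact ⟨a + b, A.add_mem _ _ ha hb, by simp⟩)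
  have hM' : ∀ y, y ∈ M ↔ y ∈ prd A B := by
    intro y; rw [hM]; simp
  have := hF (M : Set K) ⟨Or.inl ⟨M, rfl⟩, fun y hy => (hM' y).2 (prd_left bB hy),
    fun y hy => (hM' y).2 (prd_right bA hy), fun W' hW' h1 h2 y hy => by
      obtain ⟨p, hp, q, hq, rfl⟩ := (hM' y).1 hy
      exact (ball_of_loc hW').mul _ (h1 hp) _ (h2 hq)⟩
  exact (hM' _).1 this.2

lemma ord_half {A B : Set K} (hA : IsOrderingLocality A) (hB : IsOrderingLocality B)
    (M : ValuationSubring K) (hM : ∀ y, y ∈ M ↔ ∃ k : ℕ, ∃ u ∈ prd A B, y = 2 ^ k * u)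
    {x : K} (hx : x ∈ A) (h : ∀ y ∈ B, x - y ∉ mball (M : Set K)) : (2 : K) ∈ prd A B := by
  have bA := (ball_of_ord hA).1
  have bB := (ball_of_ord hB).1
  have hAM : ∀ a ∈ A, a ∈ M := fun a ha => (hM a).2 ⟨0, a, prd_left bB ha, by simp⟩
  have hBM : ∀ a ∈ B, a ∈ M := fun a ha => (hM a).2 ⟨0, a, prd_right bA ha, by simp⟩
  have hxB : x ∉ B := by
    intro hxB
    apply h x hxB
    rw [sub_self]
    exact ⟨M.zero_mem, fun h => h.2.1 rfl⟩
  obtain ⟨e, he, hg⟩ := ord_growth hB hxB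
  have h1 := h e he
  have h2 : x - e ≠ 0 ∧ (x - e)⁻¹ ∈ (M : Set K) := by
    by_contra hc
    exact h1 ⟨M.sub_mem (hAM _ hx) (hBM _ he), fun h => hc h.2⟩
  obtain ⟨k, u, ⟨p, hp, q, hq, rfl⟩, hu⟩ := (hM _).1 h2.2
  have hx0 : x ≠ 0 := by rintro rfl; exact hxB bB.zero
  rcases hg k p q hq (by rw [← hu]; exact mul_inv_cancel₀ h2.1) with h3 | ⟨N, h3⟩
  · have hp0 : p ≠ 0 := by
      rintro rfl
      have := inv_ne_zero h2.1
      rw [hu] at this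
      simp at this
    exact ⟨p, hp, 2 / p, h3, by field_simp⟩
  · exact ⟨x ^ N, bA.pow hx N, 2 / x ^ N, h3, by field_simp⟩

lemma ord_two_ne {A : Set K} (hA : IsOrderingLocality A) : (2 : K) ≠ 0 ∧ (2 : K)⁻¹ ∈ A := by
  obtain ⟨L, I, h⟩ := ord_ball hA
  refine ⟨by norm_num, ?_⟩
  rw [h, abs_of_pos (by norm_num)]
  norm_num

lemma ord_case {t : K} {A B : Set K} (hA : IsOrderingLocality A) (hB : IsOrderingLocality B)
    (hF : ∀ W, IsFCC A B W → t ∈ W ∧ t⁻¹ ∈ W) (hS : StronglyIncomp A B) : t⁻¹ ∈ prd A B := by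
  obtain ⟨bA, hs⟩ := ball_of_ord hA
  have bB := (ball_of_ord hB).1
  have h20 := ord_two_ne hA
  obtain ⟨M, hM⟩ := exists_gen bA bB 2 h20.2 h20.1 hs
  have hfcc : IsFCC A B (M : Set K) := by
    refine ⟨Or.inl ⟨M, rfl⟩, fun a ha => (hM a).2 ⟨0, a, prd_left bB ha, by simp⟩,
      fun a ha => (hM a).2 ⟨0, a, prd_right bA ha, by simp⟩, fun W hW h1 h2 => ?_⟩
    have h2W : (2 : K) ∈ W := by
      rcases hW with ⟨V, rfl⟩ | hW | ⟨f, rfl⟩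
      · have := V.add_mem _ _ V.one_mem V.one_mem
        rwa [one_add_one_eq_two] at this
      · exfalso
        apply hS.1.1
        rw [ord_eq hA hW h1, ord_eq hB hW h2]
      · by_contra hc
        simp only [Set.mem_ofPred_eq, not_le] at hc
        exact hS.1.1 (h1.trans (ord_abs hB f h2 hc))
    have bW := ball_of_loc hW
    intro y hy
    obtain ⟨k, u, ⟨p, hp, q, hq, rfl⟩, rfl⟩ := (hM y).1 hy
    exact bW.mul _ (bW.pow h2W k) _ (bW.mul _ (h1 hp) _ (h2 hq))
  have h2 : (2 : K) ∈ prd A B := by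
    have h3 := hS.2 _ hfcc
    unfold SameResidue at h3
    rw [not_and_or] at h3
    rcases h3 with h3 | h3
    · push Not at h3
      obtain ⟨x, hx, h⟩ := h3
      exact ord_half hA hB M hM hx h
    · push Not at h3
      obtain ⟨x, hx, h⟩ := h3
      rw [prd_comm]
      refine ord_half hB hA M (by rwa [prd_comm B A]) hx fun y hy hc => h y hy ?_
      have hneg : ∀ c : K, c ∈ mball (M : Set K) → -c ∈ mball (M : Set K) := by
        rintro c ⟨h1, h2⟩
        refine ⟨M.neg_mem _ h1, fun h3 => h2 ⟨h1, ?_, ?_⟩⟩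
        · intro h; exact h3.2.1 (by simp [h])
        · have := M.neg_mem _ h3.2.2
          rw [← inv_neg, neg_neg] at this
          exact this
      have := hneg _ hc
      rwa [neg_sub] at this
  obtain ⟨k, u, hu, e⟩ := (hM _).1 (hF _ hfcc).2
  rw [e]
  exact prd_mul bA bB (prd_pow bA bB h2 k) hu

lemma fcc_comm {A B W : Set K} (h : IsFCC A B W) : IsFCC B A W :=
  ⟨h.1, h.2.2.1, h.2.1, fun W' h1 h2 h3 => h.2.2.2 W' h1 h3 h2⟩

lemma tindep_prd {t : K} {A B : Set K} (hA : IsLocality A) (hB : IsLocality B)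
    (h : TIndep t A B) : t⁻¹ ∈ prd A B := by
  obtain ⟨hF, hS⟩ := h
  rcases hB with hBv | hBo | hBa
  · rw [prd_comm]; exact val_case hBv hA fun W hW => hF W (fcc_comm hW)
  · rcases hA with hAv | hAo | hAa
    · exact val_case hAv (Or.inr (Or.inl hBo)) hF
    · exact ord_case hAo hBo hF (hS hAo hBo)
    · rw [prd_comm]
      exact abs_case (Or.inr (Or.inl hBo)) hAa fun W hW => hF W (fcc_comm hW)
  · exact abs_case hA hBa hF

/-- A ball satisfying the conditions of Assumption (U) (with `d = e + 2`), in usable form. -/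
structure Good (t : K) (f : Polynomial K) (e : ℕ) (O : Set K) : Prop extends Ball O where
  t_mem : t ∈ O
  add : ∀ a ∈ O, ∀ b ∈ O, t * (a + b) ∈ O
  inn : ∀ y ∈ O, f.eval y ∈ O ∧ f.eval y ≠ 0 ∧ t / f.eval y ∈ O
  out : ∀ y ∉ O, ∃ s ∈ O, f.eval y = y ^ (e + 2) * s ∧ s ≠ 0 ∧ t / s ∈ O ∧
    ∃ u ∈ O, f.eval y = f.leadingCoeff * y ^ (e + 2) + y ^ (e + 1) * u
  lead : t * f.leadingCoeff ∈ O

lemma not_mball {O : Set K} (h : Ball O) {t s : K} (ht : t ≠ 0) (hs : s ∉ scale t (mball O)) :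
    s ≠ 0 ∧ t / s ∈ O := by
  have hs0 : s ≠ 0 := by
    rintro rfl
    exact hs ⟨0, ⟨h.zero, fun h => h.2.1 rfl⟩, by simp⟩
  refine ⟨hs0, ?_⟩
  rcases h.tot (t / s) with h1 | h1
  · exact h1
  · by_contra hc
    rw [inv_div] at h1
    refine hs ⟨s / t, ⟨h1, fun h2 => hc ?_⟩, by field_simp⟩
    have := h2.2.2
    rwa [inv_div] at this

lemma good_of {t : K} (ht : t ≠ 0) {f : Polynomial K} {e : ℕ} (he : f.natDegree = e + 2)
    {O : Set K} (h : Ball O) (h1 : CondI f O) (h2 : CondII t f O) (h3 : CondIII t f O)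
    (h4 : CondIV t O) : Good t f e O := by
  have hadd : ∀ a ∈ O, ∀ b ∈ O, t * (a + b) ∈ O := by
    intro a ha b hb
    obtain ⟨s, hs, e⟩ := h4 a ha b hb
    rw [e, mul_inv_cancel_left₀ ht]
    exact hs
  have htm : t ∈ O := by simpa using hadd 1 h.one 0 h.zero
  have hout : ∀ y ∉ O, ∃ s ∈ O, f.eval y = y ^ (e + 2) * s ∧ s ≠ 0 ∧ t / s ∈ O ∧
    ∃ u ∈ O, f.eval y = f.leadingCoeff * y ^ (e + 2) + y ^ (e + 1) * u := by
    intro y hy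
    obtain ⟨⟨s, ⟨hs, hs'⟩, es⟩, u, hu, eu⟩ := h3 y hy
    rw [he] at es eu
    obtain ⟨hs0, hts⟩ := not_mball h ht hs'
    exact ⟨s, hs, es, hs0, hts, u, hu, eu⟩
  refine ⟨h, htm, hadd, fun y hy => ⟨h1 y hy, not_mball h ht (h2 y hy)⟩, hout, ?_⟩
  by_cases hx : ∃ y, y ∉ O
  · obtain ⟨y, hy⟩ := hx
    obtain ⟨s, hs, es, -, -, u, hu, eu⟩ := hout y hy
    have hy0 : y ≠ 0 := by rintro rfl; exact hy h.zero
    have hyi : y⁻¹ ∈ O := (h.tot y).resolve_left hy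
    have : f.leadingCoeff = s + -(y⁻¹ * u) := by
      rw [es] at eu
      have h5 : y ^ (e + 2) ≠ 0 := pow_ne_zero _ hy0
      apply mul_right_cancel₀ h5
      have h6 : (s + -(y⁻¹ * u)) * y ^ (e + 2) = y ^ (e + 2) * s - y ^ (e + 1) * u := by
        rw [pow_succ y (e + 1)]; field_simp; ring
      rw [h6, eu]; ring
    rw [this]
    exact hadd _ hs _ (h.neg _ (h.mul _ hyi _ hu))
  · push Not at hx
    exact hx _

namespace Good

variable {t : K} {f : Polynomial K} {e : ℕ} {O : Set K}

lemma ne (h : Good t f e O) (y : K) : f.eval y ≠ 0 := by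
  by_cases hy : y ∈ O
  · exact (h.inn y hy).2.1
  · obtain ⟨s, hs, es, hs0, -⟩ := h.out y hy
    have hy0 : y ≠ 0 := by rintro rfl; exact hy h.zero
    rw [es]
    exact mul_ne_zero (pow_ne_zero _ hy0) hs0

lemma lower (h : Good t f e O) (y : K) : t / f.eval y ∈ O ∧ t * y / f.eval y ∈ O := by
  by_cases hy : y ∈ O
  · have := (h.inn y hy).2.2
    refine ⟨this, ?_⟩
    rw [mul_div_right_comm]
    exact h.mul _ this _ hy
  · obtain ⟨s, hs, es, hs0, hts, -⟩ := h.out y hy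
    have hy0 : y ≠ 0 := by rintro rfl; exact hy h.zero
    have hyi : y⁻¹ ∈ O := (h.tot y).resolve_left hy
    rw [es]
    constructor
    · have : t / (y ^ (e + 2) * s) = y⁻¹ ^ (e + 2) * (t / s) := by
        rw [inv_pow]; field_simp
      rw [this]
      exact h.mul _ (h.pow hyi _) _ hts
    · have : t * y / (y ^ (e + 2) * s) = y⁻¹ ^ (e + 1) * (t / s) := by
        rw [inv_pow, pow_succ y (e + 1)]; field_simp
      rw [this]
      exact h.mul _ (h.pow hyi _) _ hts

lemma eval_mem (h : Good t f e O) (W : ValuationSubring K) (hW : O ⊆ W) {y : K} (hy : y ∈ W) :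
    f.eval y ∈ W := by
  by_cases hy' : y ∈ O
  · exact hW (h.inn y hy').1
  · obtain ⟨s, hs, es, -⟩ := h.out y hy'
    rw [es]
    exact W.mul_mem _ _ (W.toSubring.pow_mem hy _) (hW hs)

lemma phi_aux (h : Good t f e O) {x y : K} (hx : x ≠ 0) (hy : y ≠ 0) :
    ∃ m s : K, m ≠ 0 ∧ s ≠ 0 ∧ (m = x ∨ m = y) ∧ x / m ∈ O ∧ y / m ∈ O ∧ s ∈ O ∧ t / s ∈ O ∧
      y ^ (e + 2) * f.eval (x / y) = m ^ (e + 2) * s := by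
  by_cases hxy : x / y ∈ O
  · obtain ⟨h1, h2, h3⟩ := h.inn _ hxy
    exact ⟨y, f.eval (x / y), hy, h2, Or.inr rfl, hxy, by rw [div_self hy]; exact h.one, h1, h3,
      rfl⟩
  · obtain ⟨s, hs, es, hs0, hts, -⟩ := h.out _ hxy
    have := (h.tot (x / y)).resolve_left hxy
    rw [inv_div] at this
    refine ⟨x, s, hx, hs0, Or.inl rfl, by rw [div_self hx]; exact h.one, this, hs, hts, ?_⟩
    rw [es, div_pow]
    field_simp

lemma phi_mem (h : Good t f e O) {x y : K} (hx : x ≠ 0) (hy : y ≠ 0) (hxO : x ∈ O) (hyO : y ∈ O) :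
    y ^ (e + 2) * f.eval (x / y) ∈ O := by
  obtain ⟨m, s, hm, hs0, hor, -, -, hs, -, eq⟩ := h.phi_aux hx hy
  rw [eq]
  refine h.mul _ (h.pow ?_ _) _ hs
  rcases hor with rfl | rfl <;> assumption

lemma phi_big (h : Good t f e O) (ht : t ≠ 0) {b x y : K} (hb : b ≠ 0) (hbO : (t * b)⁻¹ ∈ O)
    (hx : x ≠ 0) (hy : y ≠ 0)
    (hor : b / x ∈ O ∨ b / y ∈ O) : b / (y ^ (e + 2) * f.eval (x / y)) ∈ O := by
  obtain ⟨m, s, hm, hs0, -, h1, h2, -, hs, eq⟩ := h.phi_aux hx hy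
  have hbm : b / m ∈ O := by
    rcases hor with h3 | h3
    · have := h.mul _ h3 _ h1
      rwa [div_mul_div_cancel₀ hx] at this
    · have := h.mul _ h3 _ h2
      rwa [div_mul_div_cancel₀ hy] at this
  have hbi : b⁻¹ ∈ O := by
    have := h.mul _ h.t_mem _ hbO
    rwa [mul_inv, mul_inv_cancel_left₀ ht] at this
  have : b / (m ^ (e + 2) * s) = (b / m) ^ (e + 2) * ((t / s) * ((t * b)⁻¹ * b⁻¹ ^ e)) := by
    rw [div_pow, inv_pow, pow_add b e 2]; field_simp
  rw [eq, this]
  exact h.mul _ (h.pow hbm _) _ (h.mul _ hs _ (h.mul _ hbO _ (h.pow hbi _)))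

end Good

section
variable {t : K} {f : Polynomial K} {e : ℕ}

lemma compact_step (ht : t ≠ 0) (hf : ∀ y, f.eval y ≠ 0) {b : K} (hb : b ≠ 0)
    (A T : Set (Set K)) (hA : ∀ v ∈ A, Good t f e v) (hT : ∀ v ∈ T, Good t f e v)
    (hbT : ∀ v ∈ T, (t * b)⁻¹ ∈ v) (hc : @IsCompact (Set K) (zarTop K) T)
    (hl : ∀ w ∈ T, ∃ p : K, p ≠ 0 ∧ (∀ v ∈ A, p ∈ v) ∧ b / p ∈ w) :
    ∃ p : K, p ≠ 0 ∧ (∀ v ∈ A, p ∈ v) ∧ ∀ w ∈ T, b / p ∈ w := by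
  letI := zarTop K
  have := hc.induction_on
    (p := fun s => ∃ p : K, p ≠ 0 ∧ (∀ v ∈ A, p ∈ v) ∧ ∀ w ∈ s ∩ T, b / p ∈ w) ?_ ?_ ?_ ?_
  · simpa using this
  · exact ⟨1, one_ne_zero, fun v hv => (hA v hv).one, by simp⟩
  · rintro s s' hs ⟨p, h1, h2, h3⟩
    exact ⟨p, h1, h2, fun w hw => h3 w ⟨hs hw.1, hw.2⟩⟩
  · rintro s s' ⟨p, h1, h2, h3⟩ ⟨q, g1, g2, g3⟩
    refine ⟨q ^ (e + 2) * f.eval (p / q), mul_ne_zero (pow_ne_zero _ g1) (hf _),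
      fun v hv => (hA v hv).phi_mem h1 g1 (h2 v hv) (g2 v hv), fun w hw => ?_⟩
    refine (hT w hw.2).phi_big ht hb (hbT w hw.2) h1 g1 ?_
    rcases hw.1 with h | h
    · exact Or.inl (h3 w ⟨h, hw.2⟩)
    · exact Or.inr (g3 w ⟨h, hw.2⟩)
  · intro w hw
    obtain ⟨p, h1, h2, h3⟩ := hl w hw
    refine ⟨{O | b / p ∈ O}, mem_nhdsWithin_of_mem_nhds (IsOpen.mem_nhds ?_ h3),
      p, h1, h2, fun w hw => hw.1⟩
    exact TopologicalSpace.isOpen_generateFrom_of_mem ⟨b / p, rfl⟩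

lemma separate (ht : t ≠ 0) (hf : ∀ y, f.eval y ≠ 0) {b : K} (hb : b ≠ 0)
    (S T : Set (Set K)) (hS : ∀ v ∈ S, Good t f e v) (hT : ∀ v ∈ T, Good t f e v)
    (hbS : ∀ v ∈ S, (t * b)⁻¹ ∈ v) (hbT : ∀ v ∈ T, (t * b)⁻¹ ∈ v)
    (hcS : @IsCompact (Set K) (zarTop K) S) (hcT : @IsCompact (Set K) (zarTop K) T)
    (hl : ∀ v ∈ S, ∀ w ∈ T, b ∈ prd v w) :
    ∃ p : K, p ≠ 0 ∧ (∀ v ∈ S, p ∈ v) ∧ ∀ w ∈ T, b / p ∈ w := by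
  have h1 : ∀ v ∈ S, ∃ p : K, p ≠ 0 ∧ (∀ v' ∈ ({v} : Set (Set K)), p ∈ v') ∧
      ∀ w ∈ T, b / p ∈ w := by
    intro v hv
    refine compact_step ht hf hb {v} T (by rintro _ rfl; exact hS _ hv) hT hbT hcT ?_
    intro w hw
    obtain ⟨p, hp, q, hq, e⟩ := hl v hv w hw
    have hp0 : p ≠ 0 := by rintro rfl; simp [hb] at e
    refine ⟨p, hp0, by rintro _ rfl; exact hp, ?_⟩
    rw [e, mul_div_cancel_left₀ _ hp0]
    exact hq
  obtain ⟨q, hq0, h2, h3⟩ := compact_step ht hf hb T S hT hS hbS hcS (by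
    intro v hv
    obtain ⟨p, hp0, h2, h3⟩ := h1 v hv
    refine ⟨b / p, div_ne_zero hb hp0, h3, ?_⟩
    rw [div_div_cancel₀ hb]
    exact h2 v rfl)
  refine ⟨b / q, div_ne_zero hb hq0, h3, fun w hw => ?_⟩
  rw [div_div_cancel₀ hb]
  exact h2 w hw

lemma separate_fin {ι : Type*} (ht : t ≠ 0) (hf : ∀ y, f.eval y ≠ 0) (b : ι → K)
    (hb : ∀ i, b i ≠ 0)
    (S : Set (Set K)) (T : ι → Set (Set K)) (hS : ∀ v ∈ S, Good t f e v)
    (hT : ∀ i, ∀ v ∈ T i, Good t f e v)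
    (hbS : ∀ i, ∀ v ∈ S, (t * b i)⁻¹ ∈ v) (hbT : ∀ i, ∀ v ∈ T i, (t * b i)⁻¹ ∈ v)
    (hcS : @IsCompact (Set K) (zarTop K) S) (hcT : ∀ i, @IsCompact (Set K) (zarTop K) (T i))
    (hl : ∀ i, ∀ v ∈ S, ∀ w ∈ T i, b i ∈ prd v w) (I : Finset ι) :
    ∃ p : K, p ≠ 0 ∧ (∀ v ∈ S, p ∈ v) ∧ ∀ i ∈ I, ∀ w ∈ T i, b i / p ∈ w := by
  classical
  induction I using Finset.induction_on with
  | empty => exact ⟨1, one_ne_zero, fun v hv => (hS v hv).one, by simp⟩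
  | insert j I hj ih =>
    obtain ⟨p, h1, h2, h3⟩ := ih
    obtain ⟨q, g1, g2, g3⟩ := separate ht hf (hb j) S (T j) hS (hT j) (hbS j) (hbT j) hcS (hcT j)
      (hl j)
    refine ⟨q ^ (e + 2) * f.eval (p / q), mul_ne_zero (pow_ne_zero _ g1) (hf _),
      fun v hv => (hS v hv).phi_mem h1 g1 (h2 v hv) (g2 v hv), fun i hi w hw => ?_⟩
    refine (hT i w hw).phi_big ht (hb i) (hbT i w hw) h1 g1 ?_
    rcases Finset.mem_insert.mp hi with rfl | hi
    · exact Or.inr (g3 w hw)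
    · exact Or.inl (h3 i hi w hw)

lemma small_side {O : Set K} (h : Good t f e O) (ht : t ≠ 0) {r g y : K} (hr : r ∈ O)
    (hg : g = r / ((t ^ 4)⁻¹ * f.eval y)) :
    ∃ c ∈ O, f.leadingCoeff * g ^ (e + 2) / f.eval g * y = t * c := by
  obtain ⟨h1, h2⟩ := h.lower y
  have hy := h.ne y
  have hg' : g = r * (t ^ 3 * (t / f.eval y)) := by rw [hg]; field_simp
  have hgO : g ∈ O := by
    rw [hg']; exact h.mul _ hr _ (h.mul _ (h.pow h.t_mem _) _ h1)
  have hfg := h.ne g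
  refine ⟨(t * f.leadingCoeff) * ((t / f.eval g) * (g ^ (e + 1) * (r * (t * y / f.eval y)))), ?_, ?_⟩
  · exact h.mul _ h.lead _ (h.mul _ (h.inn g hgO).2.2 _ (h.mul _ (h.pow hgO _) _ (h.mul _ hr _ h2)))
  · have e1 : g ^ (e + 2) = g ^ (e + 1) * (r * (t ^ 3 * (t / f.eval y))) := by
      rw [← hg']; ring
    rw [e1]
    field_simp

lemma big_side {O : Set K} (h : Good t f e O) (ht : t ≠ 0) {r g y : K} (hr : r ∈ O) (hr0 : r ≠ 0)
    (hg : g = ((t ^ 4)⁻¹ * f.eval y) / r) :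
    (1 - f.leadingCoeff * g ^ (e + 2) / f.eval g) * y ∈ O := by
  obtain ⟨h1, h2⟩ := h.lower y
  have hy := h.ne y
  have hg0 : g ≠ 0 := by
    rw [hg]; exact div_ne_zero (mul_ne_zero (inv_ne_zero (pow_ne_zero _ ht)) hy) hr0
  have hgy : y = g * (r * (t ^ 3 * (t * y / f.eval y))) := by
    rw [hg]; field_simp
  have hfg := h.ne g
  by_cases hgO : g ∈ O
  · have hl : t ^ 3 * (1 - f.leadingCoeff * g ^ (e + 2) / f.eval g) ∈ O := by
      have h3 : (t * f.leadingCoeff) * ((t / f.eval g) * g ^ (e + 2)) ∈ O :=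
        h.mul _ h.lead _ (h.mul _ (h.inn g hgO).2.2 _ (h.pow hgO _))
      have h4 := h.add _ (h.pow h.t_mem 2) _ (h.neg _ h3)
      convert h4 using 1
      field_simp
      ring
    have : (1 - f.leadingCoeff * g ^ (e + 2) / f.eval g) * y =
        (t ^ 3 * (1 - f.leadingCoeff * g ^ (e + 2) / f.eval g)) * (g * (r * (t * y / f.eval y))) := by
      nth_rw 1 [hgy]
      ring
    rw [this]
    exact h.mul _ hl _ (h.mul _ hgO _ (h.mul _ hr _ h2))
  · obtain ⟨s, hs, es, hs0, hts, u, hu, eu⟩ := h.out g hgO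
    have e1 : (1 - f.leadingCoeff * g ^ (e + 2) / f.eval g) = u / (g * s) := by
      have : f.eval g - f.leadingCoeff * g ^ (e + 2) = g ^ (e + 1) * u := by rw [eu]; ring
      rw [one_sub_div hfg, this, es, pow_succ g (e + 1)]
      field_simp
    have : u / (g * s) * y = u * ((t / s) * (r * (t ^ 2 * (t * y / f.eval y)))) := by
      nth_rw 1 [hgy]
      field_simp
    rw [e1, this]
    exact h.mul _ hu _ (h.mul _ hts _ (h.mul _ hr _ (h.mul _ (h.pow h.t_mem _) _ h2)))

lemma prd_ring (ht : t ≠ 0) {A B : Set K} (hA : Good t f e A) (hB : Good t f e B)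
    (h : t⁻¹ ∈ prd A B) : ∃ W : ValuationSubring K, ∀ y, y ∈ W ↔ y ∈ prd A B := by
  obtain ⟨W, hW⟩ := exists_gen hA.toBall hB.toBall t⁻¹ (by simpa using hA.t_mem) (inv_ne_zero ht)
    (fun a ha b hb => ⟨t * (a + b), hA.add a ha b hb, by field_simp⟩)
  refine ⟨W, fun y => ?_⟩
  rw [hW]
  constructor
  · rintro ⟨k, u, hu, rfl⟩
    exact prd_mul hA.toBall hB.toBall (prd_pow hA.toBall hB.toBall h k) hu
  · intro hy
    exact ⟨0, y, hy, by simp⟩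

lemma core (ht : t ≠ 0) (n : ℕ) : ∀ (S : Fin n → Set (Set K)) (x z : Fin n → K),
    (∀ i, z i ≠ 0) → (∀ i, ∀ v ∈ S i, Good t f e v) →
    (∀ i, @IsCompact (Set K) (zarTop K) (S i)) →
    (∀ i j, i ≠ j → ∀ v ∈ S i, ∀ w ∈ S j, t⁻¹ ∈ prd v w ∧ (x i - x j) / z i ∈ prd v w ∧
      z i / z j ∈ prd v w) →
    ∃ a : K, ∀ i, ∀ v ∈ S i, (a - x i) / z i ∈ v := by
  induction n with
  | zero => intro S x z _ _ _ _; exact ⟨0, fun i => i.elim0⟩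
  | succ n ih =>
    intro S x z hz hG hc hI
    obtain ⟨a', ha'⟩ := ih (fun i => S i.castSucc) (fun i => x i.castSucc)
      (fun i => t * z i.castSucc) (fun i => mul_ne_zero ht (hz _)) (fun i => hG _) (fun i => hc _) (by
        intro i j hij v hv w hw
        obtain ⟨h1, h2, h3⟩ := hI _ _ (fun h => hij (Fin.castSucc_injective _ h)) v hv w hw
        refine ⟨h1, ?_, ?_⟩
        · have := prd_mul (hG _ v hv).toBall (hG _ w hw).toBall h1 h2
          convert this using 1
          have := hz i.castSucc
          field_simp
        · rwa [mul_div_mul_left _ _ ht])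
    rcases (S (Fin.last n)).eq_empty_or_nonempty with hS | ⟨v0, hv0⟩
    · refine ⟨a', fun i => ?_⟩
      refine Fin.lastCases (by simp [hS]) (fun i v hv => ?_) i
      have h := hG _ v hv
      have := h.mul _ h.t_mem _ (ha' i v hv)
      convert this using 1
      have := hz i.castSucc
      field_simp
    have hf := (hG _ v0 hv0).ne
    set c := x (Fin.last n) - a' with hcdef
    let E : Fin (n + 1) → K := fun i => (t ^ 4)⁻¹ * f.eval (c / z i)
    have hE : ∀ i, E i ≠ 0 := fun i => mul_ne_zero (inv_ne_zero (pow_ne_zero _ ht)) (hf _)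
    let b : Fin n → K := fun i => E i.castSucc * E (Fin.last n)
    have hb : ∀ i, b i ≠ 0 := fun i => mul_ne_zero (hE _) (hE _)
    have hbG : ∀ O : Set K, Good t f e O → ∀ i, (t * b i)⁻¹ ∈ O := by
      intro O h i
      have h1 := (h.lower (c / z i.castSucc)).1
      have h2 := (h.lower (c / z (Fin.last n))).1
      have : (t * b i)⁻¹ = t ^ 5 * ((t / f.eval (c / z i.castSucc)) *
          (t / f.eval (c / z (Fin.last n)))) := by
        have e1 := hf (c / z i.castSucc)
        have e2 := hf (c / z (Fin.last n))
        simp only [b, E]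
        field_simp
      rw [this]
      exact h.mul _ (h.pow h.t_mem _) _ (h.mul _ h1 _ h2)
    have hbp : ∀ i, ∀ v ∈ S (Fin.last n), ∀ w ∈ S i.castSucc, b i ∈ prd v w := by
      intro i v hv w hw
      have hne : i.castSucc ≠ Fin.last n := (Fin.castSucc_lt_last i).ne
      obtain ⟨h1, h2, h3⟩ := hI _ _ hne w hw v hv
      have gw := hG _ w hw
      have gv := hG _ v hv
      rw [prd_comm]
      obtain ⟨W, hW⟩ := prd_ring ht gw gv h1
      rw [← hW] at h1 h2 h3 ⊢
      have hwW : w ⊆ W := fun y hy => (hW y).2 (prd_left gv.toBall hy)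
      have hy1 : c / z i.castSucc ∈ W := by
        have h4 := W.mul_mem _ _ (hwW gw.t_mem) (hwW (ha' i w hw))
        have h5 := W.neg_mem _ (W.add_mem _ _ h2 h4)
        convert h5 using 1
        have := hz i.castSucc
        rw [hcdef]
        field_simp
        ring
      have hy2 : c / z (Fin.last n) ∈ W := by
        have := W.mul_mem _ _ hy1 h3
        rwa [div_mul_div_cancel₀ (hz _)] at this
      have ht4 : (t ^ 4)⁻¹ ∈ W := by
        rw [← inv_pow]; exact W.toSubring.pow_mem h1 _
      exact W.mul_mem _ _ (W.mul_mem _ _ ht4 (gw.eval_mem W hwW hy1))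
        (W.mul_mem _ _ ht4 (gw.eval_mem W hwW hy2))
    obtain ⟨P, hP0, hP1, hP2⟩ := separate_fin (e := e) ht hf b hb (S (Fin.last n))
      (fun i : Fin n => S i.castSucc) (hG _) (fun i => hG _) (fun i v hv => hbG v (hG _ v hv) i)
      (fun i v hv => hbG v (hG _ v hv) i) (hc _) (fun i => hc _) hbp Finset.univ
    let g := E (Fin.last n) / P
    let l := f.leadingCoeff * g ^ (e + 2) / f.eval g
    refine ⟨a' + l * c, fun i => ?_⟩
    refine Fin.lastCases (fun v hv => ?_) (fun i v hv => ?_) i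
    · have h := hG _ v hv
      have := h.neg _ (big_side (g := g) (y := c / z (Fin.last n)) h ht (hP1 v hv) hP0 rfl)
      convert this using 1
      have e1 : x (Fin.last n) = c + a' := by rw [hcdef]; ring
      rw [e1]
      simp only [l]
      ring
    · have h := hG _ v hv
      obtain ⟨k, hk, e1⟩ := small_side (g := g) (y := c / z i.castSucc) h ht
        (hP2 i (Finset.mem_univ _) v hv) (by
          have := hE i.castSucc
          change E (Fin.last n) / P = (E i.castSucc * E (Fin.last n) / P) / E i.castSucc
          field_simp)
      have := h.add _ (ha' i v hv) _ hk
      convert this using 1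
      rw [mul_add, ← e1]
      have := hz i.castSucc
      simp only [l]
      generalize f.leadingCoeff * g ^ (e + 2) / f.eval g = l'
      field_simp
      ring

end

/-- **Theorem 4.5, Situation `O`** (main theorem, weak version). -/
theorem main_theorem_weak {K : Type*} [Field K] (n : ℕ) (S : Fin n → Set (Set K))
    (hloc : ∀ i, ∀ v ∈ S i, IsLocality v)
    (t : K) (ht : t ≠ 0) (x z : Fin n → K) (hz : ∀ i, z i ≠ 0)
    (hU : AssumptionU (⋃ i, S i) t)
    (hT : ∀ i, @IsCompact (Set K) (zarTop K) (S i))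
    (hI : ∀ i j, ∀ W : Set K, IsValuationLocality W →
      (∃ v ∈ S i, v ⊆ W) → (∃ v ∈ S j, v ⊆ W) →
      x i - x j ∈ scale (z i) W ∧ scale (z i) W = scale (z j) W)
    (hti : ∀ i j, i ≠ j → SetTIndep t (S i) (S j)) :
    ∃ a : K, ∀ i, ∀ v ∈ S i, a - x i ∈ scale (z i) v := by
  obtain ⟨f, hd, hf⟩ := hU
  obtain ⟨e, he⟩ : ∃ e, f.natDegree = e + 2 := ⟨f.natDegree - 2, by omega⟩
  have hG : ∀ i, ∀ v ∈ S i, Good t f e v := by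
    intro i v hv
    obtain ⟨h1, h2, h3, h4⟩ := hf v (Set.mem_iUnion.2 ⟨i, hv⟩)
    exact good_of ht he (ball_of_loc (hloc i v hv)) h1 h2 h3 h4
  obtain ⟨a, ha⟩ := core (f := f) (e := e) ht n S x z hz hG hT (by
    intro i j hij v hv w hw
    have h1 := tindep_prd (hloc i v hv) (hloc j w hw) (hti i j hij v hv w hw)
    obtain ⟨W, hW⟩ := prd_ring ht (hG i v hv) (hG j w hw) h1
    obtain ⟨⟨s, hs, es⟩, h3⟩ := hI i j (W : Set K) ⟨W, rfl⟩
      ⟨v, hv, fun y hy => (hW y).2 (prd_left (hG j w hw).toBall hy)⟩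
      ⟨w, hw, fun y hy => (hW y).2 (prd_right (hG i v hv).toBall hy)⟩
    refine ⟨h1, ?_, ?_⟩
    · rw [es, mul_div_cancel_left₀ _ (hz i)]
      exact (hW s).1 hs
    · have h4 : z i ∈ scale (z i) (W : Set K) := ⟨1, W.one_mem, by simp⟩
      rw [h3] at h4
      obtain ⟨r, hr, er⟩ := h4
      rw [er, mul_div_cancel_left₀ _ (hz j)]
      exact (hW r).1 hr)
  refine ⟨a, fun i v hv => ⟨_, ha i v hv, ?_⟩⟩
  rw [mul_div_cancel₀ _ (hz i)]

end PaperApprox
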